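/- arXiv:1306.0780 — 2 statements merged into one kernel-verified Lean document; each statement's English description precedes it below -/
import Mathlib

section
/- If f ∈ C^∞(ℝ₊² \ {(0,0)}) is homogeneous of any degree α ∈ ℂ, then the doubly regularized iterated integral ⨍_0^∞ ⨍_0^∞ f(x,y) dy dx vanishes, for both orders of integration. -/
open MeasureTheory Filter Asymptotics

noncomputable section

/-- A term `x ^ α * (log x) ^ k` of a partie-finie asymptotic expansion. -/
def CTerm (p : ℂ × ℕ) (x : ℝ) : ℂ :=
  (x : ℂ) ^ p.1 * (Real.log x : ℂ) ^ p.2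

/-- Hadamard partie finie regularized limit as `x → ∞`: `g` has an asymptotic expansion
`g(x) ~ ∑ A p * x ^ p.1 * log x ^ p.2 + c + o(1)` where all expansion terms are
non-decaying and non-constant; `c` is the constant term `a₀₀`. -/
def HasRegLimAtTop (g : ℝ → ℂ) (c : ℂ) : Prop :=
  ∃ (s : Finset (ℂ × ℕ)) (A : ℂ × ℕ → ℂ),
    (∀ p ∈ s, 0 ≤ p.1.re ∧ p ≠ (0, 0)) ∧
    Tendsto (fun x => g x - ∑ p ∈ s, A p * CTerm p x - c) atTop (nhds 0)

/-- Hadamard partie finie regularized limit as `x → 0⁺`. -/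
def HasRegLimAtZero (g : ℝ → ℂ) (c : ℂ) : Prop :=
  ∃ (s : Finset (ℂ × ℕ)) (A : ℂ × ℕ → ℂ),
    (∀ p ∈ s, p.1.re ≤ 0 ∧ p ≠ (0, 0)) ∧
    Tendsto (fun x => g x - ∑ p ∈ s, A p * CTerm p x - c) (nhdsWithin 0 (Set.Ioi 0)) (nhds 0)

/-- `⨍_a^∞ g = v` : the regularized integral of `g` from `a` to `∞` equals `v`.
For `a ≠ 0` it is `LIM_{R→∞} ∫_a^R g`; for `a = 0` one additionally regularizes at the
lower endpoint: `⨍_0^∞ g = LIM_{ε→0} ∫_ε^1 g + LIM_{R→∞} ∫_1^R g`. -/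
def HasRegInt (g : ℝ → ℂ) (a : ℝ) (v : ℂ) : Prop :=
  (a ≠ 0 ∧ HasRegLimAtTop (fun R => ∫ x in a..R, g x) v) ∨
  (a = 0 ∧ ∃ v₀ v₁ : ℂ,
    HasRegLimAtZero (fun e => ∫ x in e..1, g x) v₀ ∧
    HasRegLimAtTop (fun R => ∫ x in (1:ℝ)..R, g x) v₁ ∧ v = v₀ + v₁)

/-- Regularized limit of a sequence (partie finie of the expansion in `N`). -/
def HasRegLimSeq (g : ℕ → ℂ) (c : ℂ) : Prop :=
  ∃ (s : Finset (ℂ × ℕ)) (A : ℂ × ℕ → ℂ),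
    (∀ p ∈ s, 0 ≤ p.1.re ∧ p ≠ (0, 0)) ∧
    Tendsto (fun N : ℕ => g N - ∑ p ∈ s, A p * CTerm p (N : ℝ) - c) atTop (nhds 0)

/-- Regularized sum `Σ-reg_{l=l₀}^∞ g l = v`, the regularized limit of partial sums. -/
def HasRegSum (g : ℕ → ℂ) (l₀ : ℕ) (v : ℂ) : Prop :=
  HasRegLimSeq (fun N => ∑ l ∈ Finset.Icc l₀ N, g l) v

/-- The closed quarter plane minus the origin. -/
def Qset : Set (ℝ × ℝ) := {p | 0 ≤ p.1 ∧ 0 ≤ p.2} \ {0}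

/-- Homogeneity of complex degree `α` on the quarter plane. -/
def Homog (f : ℝ × ℝ → ℂ) (α : ℂ) : Prop :=
  ∀ l : ℝ, 0 < l → ∀ p : ℝ × ℝ, p ∈ Qset →
    f (l * p.1, l * p.2) = (l : ℂ) ^ α * f p

/-- Taylor coefficient `c_j = (∂₁^j f)(0,1)/j!` of the expansion of `f` as `y → ∞`. -/
def cCoef (f : ℝ × ℝ → ℂ) (j : ℕ) : ℂ :=
  (j.factorial : ℂ)⁻¹ * iteratedDerivWithin j (fun t => f (t, 1)) (Set.Ici 0) 0

/-- Taylor coefficient `d_j = (∂₂^j f)(1,0)/j!` of the expansion of `f` as `x → ∞`. -/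
def dCoef (f : ℝ × ℝ → ℂ) (j : ℕ) : ℂ :=
  (j.factorial : ℂ)⁻¹ * iteratedDerivWithin j (fun t => f (1, t)) (Set.Ici 0) 0

open Classical in
/-- `c_{α+1}`: the coefficient `c_j` with `j = α + 1` if `α + 1 ∈ ℕ`, and `0` otherwise. -/
def cCrit (f : ℝ × ℝ → ℂ) (α : ℂ) : ℂ :=
  if h : ∃ j : ℕ, α + 1 = (j : ℂ) then cCoef f h.choose else 0

open Classical in
/-- `d_{α+1}`: the coefficient `d_j` with `j = α + 1` if `α + 1 ∈ ℕ`, and `0` otherwise. -/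
def dCrit (f : ℝ × ℝ → ℂ) (α : ℂ) : ℂ :=
  if h : ∃ j : ℕ, α + 1 = (j : ℂ) then dCoef f h.choose else 0

end

open Polynomial

/-- `g t` is asymptotic, up to `o(1)` as `t → ∞`, to `∑ₐ P a (t) * exp (a * t)`, where the
formal sum over all exponents `a` is evaluated along sufficiently large finite sets. -/
def ExpPolyAsymp (g : ℝ → ℂ) (P : ℂ → ℂ[X]) : Prop :=
  ∀ᶠ S : Finset ℂ in atTop,
    Tendsto (fun t : ℝ => g t - ∑ a ∈ S, (P a).eval (t : ℂ) * Complex.exp (a * t)) atTop (nhds 0)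

theorem exists_real_exp_ne {a b : ℂ} (hab : a ≠ b) :
    ∃ h : ℝ, Complex.exp (b * h) ≠ Complex.exp (a * h) := by
  by_contra! H
  have hd : ∀ c : ℂ, HasDerivAt (fun h : ℝ => Complex.exp (c * h)) c 0 := by
    intro c
    have h1 : HasDerivAt (fun h : ℝ => c * (h : ℂ)) (c * 1) 0 :=
      (Complex.ofRealCLM.hasDerivAt (x := (0 : ℝ))).const_mul c
    simpa using h1.cexp
  have hb := hd b
  rw [funext H] at hb
  exact hab ((hd a).unique hb)

theorem eval_taylor_real (u t : ℝ) (p : ℂ[X]) :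
    (taylor (u : ℂ) p).eval (t : ℂ) = p.eval ((t + u : ℝ) : ℂ) := by
  simp [taylor_eval]

/-- An exponential polynomial without decaying exponents that tends to zero is trivial. -/
theorem expPoly_eq_zero_of_tendsto (S : Finset ℂ) :
    ∀ P : ℂ → ℂ[X], (∀ a ∈ S, 0 ≤ a.re) →
      Tendsto (fun t : ℝ => ∑ a ∈ S, (P a).eval (t : ℂ) * Complex.exp (a * t)) atTop (nhds 0) →
      ∀ a ∈ S, P a = 0 := by
  classical
  induction S using Finset.induction_on with
  | empty => simp
  | insert a₁ S ha₁ ih =>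
    intro P hre hP
    obtain ⟨n, hn⟩ : ∃ n : ℕ, (P a₁).degree < n :=
      ⟨(P a₁).natDegree + 1, degree_le_natDegree.trans_lt (by exact_mod_cast Nat.lt_succ_self _)⟩
    induction n generalizing P with
    | zero =>
      have h0 : P a₁ = 0 := by
        simpa [Nat.WithBot.lt_zero_iff] using hn
      have h1 := ih P (fun a ha => hre a (Finset.mem_insert_of_mem ha)) (by
        simpa [Finset.sum_insert ha₁, h0] using hP)
      intro a ha
      rcases Finset.mem_insert.1 ha with rfl | ha
      · exact h0
      · exact h1 a ha
    | succ n ihn =>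
      -- `g (t + h) - exp (a₁ h) g t` lowers the degree of the coefficient of `exp (a₁ t)`
      have key : ∀ h : ℝ, ∀ a ∈ insert a₁ S,
          Complex.exp (a * h) • taylor (h : ℂ) (P a) = Complex.exp (a₁ * h) • P a := by
        intro h a ha
        rw [← sub_eq_zero]
        refine ihn (fun a => Complex.exp (a * h) • taylor (h : ℂ) (P a)
          - Complex.exp (a₁ * h) • P a) ?_ ?_ a ha
        · have h1 := (hP.comp (tendsto_atTop_add_const_right atTop h tendsto_id)).sub
            (hP.const_mul (Complex.exp (a₁ * h)))
          simp only [mul_zero, sub_zero] at h1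
          refine h1.congr fun t => ?_
          simp only [Function.comp, id, Finset.mul_sum, ← Finset.sum_sub_distrib]
          refine Finset.sum_congr rfl fun a _ => ?_
          rw [eval_sub, eval_smul, eval_smul, eval_taylor_real, smul_eq_mul, smul_eq_mul]
          push_cast
          rw [mul_add, Complex.exp_add]
          ring
        · rw [← smul_sub]
          refine (degree_smul_le _ _).trans_lt ?_
          by_cases h0 : P a₁ = 0
          · simp [h0]
          have hlt := degree_sub_lt_left (p := taylor (h : ℂ) (P a₁)) (q := P a₁) (by simp)
            (by simpa using h0) (by simp)
          rw [degree_taylor] at hlt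
          refine hlt.trans_le ?_
          rw [degree_eq_natDegree h0] at hn ⊢
          exact Nat.cast_le.2 (Nat.lt_succ_iff.1 (Nat.cast_lt.1 hn))
      have hS : ∀ b ∈ S, P b = 0 := by
        intro b hb
        have hne : a₁ ≠ b := fun h => ha₁ (h ▸ hb)
        obtain ⟨h, hh⟩ := exists_real_exp_ne hne
        have h1 := congrArg (fun p => p.coeff (P b).natDegree)
          (key h b (Finset.mem_insert_of_mem hb))
        have h2 : (taylor (h : ℂ) (P b)).coeff (P b).natDegree = (P b).leadingCoeff := by
          simp
        simp only [coeff_smul, h2, smul_eq_mul, coeff_natDegree] at h1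
        by_contra h0
        exact hh (mul_right_cancel₀ (leadingCoeff_ne_zero.2 h0) h1)
      have hconst : P a₁ = C ((P a₁).eval 0) := by
        refine eq_of_infinite_eval_eq _ _ ?_
        refine (Set.infinite_range_of_injective Complex.ofReal_injective).mono ?_
        rintro _ ⟨h, rfl⟩
        have h1 := smul_right_injective _ (Complex.exp_ne_zero (a₁ * h))
          (key h a₁ (Finset.mem_insert_self _ _))
        have h2 := congrArg (eval 0) h1
        simpa [taylor_eval] using h2
      have hc : (P a₁).eval 0 = 0 := by
        have h1 : Tendsto (fun t : ℝ => (P a₁).eval 0 * Complex.exp (a₁ * t)) atTop (nhds 0) := by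
          refine hP.congr fun t => ?_
          rw [Finset.sum_insert ha₁, Finset.sum_eq_zero fun b hb => by simp [hS b hb], add_zero]
          conv_lhs => rw [hconst]
          rw [eval_C]
        have h2 : ∀ᶠ t : ℝ in atTop,
            ‖(P a₁).eval 0‖ ≤ ‖(P a₁).eval 0 * Complex.exp (a₁ * t)‖ := by
          filter_upwards [eventually_ge_atTop 0] with t ht
          rw [norm_mul, Complex.norm_exp]
          refine le_mul_of_one_le_right (norm_nonneg _) (Real.one_le_exp ?_)
          have := hre a₁ (Finset.mem_insert_self _ _)
          simpa using mul_nonneg this ht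
        have h3 := ge_of_tendsto h1.norm h2
        simpa using h3
      intro a ha
      rcases Finset.mem_insert.1 ha with rfl | ha
      · rw [hconst, hc, C_0]
      · exact hS a ha

theorem tendsto_eval_mul_exp_of_re_neg (p : ℂ[X]) {a : ℂ} (ha : a.re < 0) :
    Tendsto (fun t : ℝ => p.eval (t : ℂ) * Complex.exp (a * t)) atTop (nhds 0) := by
  induction p using Polynomial.induction_on' with
  | add p q hp hq =>
    simpa [add_mul] using hp.add hq
  | monomial n c =>
    have h1 := tendsto_rpow_mul_exp_neg_mul_atTop_nhds_zero (n : ℝ) (-a.re) (by linarith)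
    rw [tendsto_zero_iff_norm_tendsto_zero]
    have h2 := h1.const_mul ‖c‖
    rw [mul_zero] at h2
    refine h2.congr' ?_
    filter_upwards [eventually_ge_atTop 0] with t ht
    simp [Complex.norm_exp, abs_of_nonneg ht, mul_assoc]

namespace ExpPolyAsymp

variable {g g₁ g₂ : ℝ → ℂ} {P P₁ P₂ : ℂ → ℂ[X]}

theorem congr (h : ExpPolyAsymp g₁ P) (hg : ∀ t, g₁ t = g₂ t) : ExpPolyAsymp g₂ P :=
  funext hg ▸ h

theorem add (h₁ : ExpPolyAsymp g₁ P₁) (h₂ : ExpPolyAsymp g₂ P₂) :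
    ExpPolyAsymp (fun t => g₁ t + g₂ t) (fun a => P₁ a + P₂ a) := by
  filter_upwards [h₁, h₂] with S hS₁ hS₂
  have := hS₁.add hS₂
  rw [add_zero] at this
  refine this.congr fun t => ?_
  simp only [eval_add, add_mul, Finset.sum_add_distrib]
  ring

theorem const_mul (c : ℂ) (h : ExpPolyAsymp g P) :
    ExpPolyAsymp (fun t => c * g t) (fun a => C c * P a) := by
  filter_upwards [h] with S hS
  have := hS.const_mul c
  rw [mul_zero] at this
  refine this.congr fun t => ?_
  simp only [eval_mul, eval_C, mul_assoc, ← Finset.mul_sum]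
  ring

theorem of_tendsto_zero (h : Tendsto g atTop (nhds 0)) : ExpPolyAsymp g (fun _ => 0) :=
  Eventually.of_forall fun S => by simpa using h

theorem eval_mul_exp (β : ℂ) (V : ℂ[X]) :
    ExpPolyAsymp (fun t => V.eval (t : ℂ) * Complex.exp (β * t)) (Pi.single β V) := by
  filter_upwards [eventually_ge_atTop {β}] with S hS
  have hβ : β ∈ S := hS (Finset.mem_singleton_self β)
  refine tendsto_const_nhds.congr fun t => ?_
  rw [Finset.sum_eq_single_of_mem β hβ fun b _ hb => by simp [Pi.single_eq_of_ne hb]]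
  simp

theorem const (c : ℂ) : ExpPolyAsymp (fun _ => c) (Pi.single 0 (C c)) := by
  simpa using eval_mul_exp 0 (C c)

theorem sum {ι : Type*} (s : Finset ι) {g : ι → ℝ → ℂ} {P : ι → ℂ → ℂ[X]}
    (h : ∀ i ∈ s, ExpPolyAsymp (g i) (P i)) :
    ExpPolyAsymp (fun t => ∑ i ∈ s, g i t) (fun a => ∑ i ∈ s, P i a) := by
  classical
  induction s using Finset.induction_on with
  | empty => simpa using of_tendsto_zero tendsto_const_nhds
  | insert i s hi ih =>
    simp only [Finset.sum_insert hi]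
    exact (h i (Finset.mem_insert_self _ _)).add
      (ih fun j hj => h j (Finset.mem_insert_of_mem hj))

theorem comp_add_const (h : ExpPolyAsymp g P) (u : ℝ) :
    ExpPolyAsymp (fun t => g (t + u))
      (fun a => C (Complex.exp (a * u)) * taylor (u : ℂ) (P a)) := by
  filter_upwards [h] with S hS
  refine (hS.comp (tendsto_atTop_add_const_right atTop u tendsto_id)).congr fun t => ?_
  simp only [Function.comp, id, sub_right_inj]
  refine Finset.sum_congr rfl fun a _ => ?_
  rw [eval_mul, eval_C, eval_taylor_real]
  push_cast
  rw [mul_add, Complex.exp_add]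
  ring

theorem eq_at_zero (h₁ : ExpPolyAsymp g P₁) (h₂ : ExpPolyAsymp g P₂) : P₁ 0 = P₂ 0 := by
  classical
  have h := h₁.add (h₂.const_mul (-1))
  obtain ⟨S, hS, h0⟩ := (h.and (eventually_ge_atTop {0})).exists
  set D : ℂ → ℂ[X] := fun a => P₁ a + C (-1) * P₂ a with hD
  have hneg : Tendsto (fun t : ℝ => ∑ a ∈ S with ¬ 0 ≤ a.re,
      (D a).eval (t : ℂ) * Complex.exp (a * t)) atTop (nhds 0) := by
    simpa using tendsto_finsetSum _ fun a ha =>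
      tendsto_eval_mul_exp_of_re_neg (D a) (not_le.1 (Finset.mem_filter.1 ha).2)
  have hpos : Tendsto (fun t : ℝ => ∑ a ∈ S with 0 ≤ a.re,
      (D a).eval (t : ℂ) * Complex.exp (a * t)) atTop (nhds 0) := by
    have := (hS.add hneg).neg
    rw [add_zero, neg_zero] at this
    refine this.congr fun t => ?_
    rw [← Finset.sum_filter_add_sum_filter_not S (fun a => 0 ≤ a.re)]
    ring
  have := expPoly_eq_zero_of_tendsto _ D (fun a ha => (Finset.mem_filter.1 ha).2) hpos 0
    (Finset.mem_filter.2 ⟨h0 (Finset.mem_singleton_self 0), by simp⟩)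
  simp only [hD, C_neg, C_1, neg_one_mul] at this
  exact add_neg_eq_zero.1 this

end ExpPolyAsymp

theorem CTerm_exp (p : ℂ × ℕ) (t : ℝ) :
    CTerm p (Real.exp t) = (X ^ p.2 : ℂ[X]).eval (t : ℂ) * Complex.exp (p.1 * t) := by
  rw [CTerm, Complex.cpow_def_of_ne_zero (by exact_mod_cast (Real.exp_pos t).ne'),
    ← Complex.ofReal_log (Real.exp_pos t).le, Real.log_exp]
  simp [mul_comm]

theorem HasRegLimAtTop.exists_expPolyAsymp {g : ℝ → ℂ} {c : ℂ} (h : HasRegLimAtTop g c) :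
    ∃ P, ExpPolyAsymp (fun t => g (Real.exp t)) P ∧ (P 0).coeff 0 = c := by
  obtain ⟨s, A, hs, hg⟩ := h
  have h1 := ExpPolyAsymp.of_tendsto_zero (hg.comp Real.tendsto_exp_atTop)
  have h2 := ExpPolyAsymp.sum s fun p _ =>
    (ExpPolyAsymp.eval_mul_exp p.1 (X ^ p.2)).const_mul (A p)
  refine ⟨_, ((h1.add h2).add (.const c)).congr fun t => ?_, ?_⟩
  · simp only [Function.comp, CTerm_exp]
    ring
  have h3 : ∀ p ∈ s, (C (A p) * (Pi.single p.1 (X ^ p.2) : ℂ → ℂ[X]) 0).coeff 0 = 0 := by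
    rintro ⟨a, k⟩ hp
    by_cases ha : a = 0
    · subst ha
      have hk : k ≠ 0 := fun hk => (hs _ hp).2 (by rw [hk])
      simp [coeff_X_pow, hk.symm]
    · simp [Pi.single_eq_of_ne (Ne.symm ha)]
  simp only [coeff_add, finsetSum_coeff, Pi.single_eq_same, coeff_C_zero, coeff_zero]
  rw [Finset.sum_eq_zero h3]
  simp

theorem HasRegLimAtZero.hasRegLimAtTop_inv {g : ℝ → ℂ} {c : ℂ} (h : HasRegLimAtZero g c) :
    HasRegLimAtTop (fun x => g x⁻¹) c := by
  classical
  obtain ⟨s, A, hs, hg⟩ := h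
  let e : ℂ × ℕ → ℂ × ℕ := fun p => (-p.1, p.2)
  have he : Function.Involutive e := fun p => by simp [e]
  refine ⟨s.image e, fun p => A (e p) * (-1) ^ p.2, ?_, ?_⟩
  · simp only [Finset.mem_image]
    rintro _ ⟨p, hp, rfl⟩
    refine ⟨by simpa [e] using (hs p hp).1, fun h0 => (hs p hp).2 ?_⟩
    rw [← he p, h0]
    simp [e]
  · refine (hg.comp tendsto_inv_atTop_nhdsGT_zero).congr' ?_
    filter_upwards [eventually_gt_atTop 0] with x hx
    rw [Finset.sum_image he.injective.injOn]
    simp only [Function.comp, sub_left_inj, sub_right_inj]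
    refine Finset.sum_congr rfl fun p _ => ?_
    rw [he p]
    have h1 : ((x⁻¹ : ℝ) : ℂ) ^ p.1 = (x : ℂ) ^ (-p.1) := by
      rw [Complex.ofReal_inv, Complex.inv_cpow _ _ (by
        rw [Complex.arg_ofReal_of_nonneg hx.le]; exact Real.pi_pos.ne), Complex.cpow_neg]
    simp only [CTerm, e, h1, Real.log_inv, Complex.ofReal_neg]
    rw [neg_pow (Real.log x : ℂ)]
    ring

theorem HasRegLimAtZero.exists_expPolyAsymp {g : ℝ → ℂ} {c : ℂ} (h : HasRegLimAtZero g c) :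
    ∃ P, ExpPolyAsymp (fun t => g (Real.exp (-t))) P ∧ (P 0).coeff 0 = c := by
  simpa [Real.exp_neg] using h.hasRegLimAtTop_inv.exists_expPolyAsymp

/-- The polynomial solution of `β V + V' = W`, normalised at `0` in the resonant case. -/
theorem exists_polynomial_ode_solution (β : ℂ) (W : ℂ[X]) :
    ∃ V : ℂ[X], C β * V + derivative V = W ∧ (β = 0 → V.coeff 0 = 0) := by
  induction W using Polynomial.induction_on' with
  | add W₁ W₂ h₁ h₂ =>
    obtain ⟨V₁, h₁, h₁'⟩ := h₁
    obtain ⟨V₂, h₂, h₂'⟩ := h₂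
    refine ⟨V₁ + V₂, ?_, fun h => by rw [coeff_add, h₁' h, h₂' h, add_zero]⟩
    rw [← h₁, ← h₂, derivative_add]
    ring
  | monomial n c =>
    by_cases hβ : β = 0
    · refine ⟨monomial (n + 1) (c / (n + 1)), ?_, fun _ => by simp [coeff_monomial]⟩
      have : (n + 1 : ℂ) ≠ 0 := by exact_mod_cast n.succ_ne_zero
      simp [hβ, this]
    · suffices H : ∃ V : ℂ[X], C β * V + derivative V = X ^ n by
        obtain ⟨V, hV⟩ := H
        refine ⟨C c * V, ?_, fun h => absurd h hβ⟩
        rw [derivative_C_mul, ← C_mul_X_pow_eq_monomial, ← hV]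
        ring
      have hC : C β * C β⁻¹ = (1 : ℂ[X]) := by rw [← C_mul, mul_inv_cancel₀ hβ, C_1]
      induction n with
      | zero => exact ⟨C β⁻¹, by simp [hC]⟩
      | succ n ih =>
        obtain ⟨V, hV⟩ := ih
        refine ⟨C β⁻¹ * (X ^ (n + 1) - C (n + 1 : ℂ) * V), ?_⟩
        have hd : derivative (X ^ (n + 1) : ℂ[X]) = C (n + 1 : ℂ) * X ^ n := by
          simp
        rw [derivative_C_mul, derivative_sub, derivative_C_mul, hd]
        linear_combination (X ^ (n + 1) - C (n + 1 : ℂ) * V) * hC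
          - C β⁻¹ * C (n + 1 : ℂ) * hV + C (n + 1 : ℂ) * V * hC

/-- The regularized integral of `x ^ γ * W (log x)` over the half line vanishes. -/
theorem HasRegInt.eq_zero_of_cpow_mul_log {F : ℝ → ℂ} {I : ℂ} (γ : ℂ) (W : ℂ[X])
    (hF : ∀ u : ℝ, F (Real.exp u) = Complex.exp (γ * u) * W.eval (u : ℂ))
    (h : HasRegInt F 0 I) : I = 0 := by
  obtain ⟨V, hV, hV0⟩ := exists_polynomial_ode_solution (γ + 1) W
  set J : ℝ → ℂ := fun u => V.eval (u : ℂ) * Complex.exp ((γ + 1) * u) with hJ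
  have hJd : ∀ u : ℝ, HasDerivAt J (Complex.exp ((γ + 1) * u) * W.eval (u : ℂ)) u := by
    intro u
    have h1 : HasDerivAt (fun u : ℝ => V.eval (u : ℂ)) ((derivative V).eval (u : ℂ)) u :=
      (V.hasDerivAt (u : ℂ)).comp_ofReal
    have h2 : HasDerivAt (fun u : ℝ => (γ + 1) * (u : ℂ)) ((γ + 1) * 1) u :=
      (Complex.ofRealCLM.hasDerivAt (x := u)).const_mul _
    refine (h1.mul h2.cexp).congr_deriv ?_
    rw [← hV, eval_add, eval_mul, eval_C]
    ring
  have hFd : ∀ x : ℝ, 0 < x → HasDerivAt (fun x => J (Real.log x)) (F x) x := by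
    intro x hx
    refine ((hJd (Real.log x)).scomp x (Real.hasDerivAt_log hx.ne')).congr_deriv ?_
    conv_rhs => rw [← Real.exp_log hx, hF]
    have h1 : Complex.exp (Real.log x) = x := by
      rw [← Complex.ofReal_exp, Real.exp_log hx]
    have hx' : (x : ℂ) ≠ 0 := by exact_mod_cast hx.ne'
    rw [add_mul, one_mul, Complex.exp_add, h1, Complex.real_smul, Complex.ofReal_inv]
    field_simp
  have integral_F : ∀ a b : ℝ, ∫ x in (Real.exp a)..(Real.exp b), F x = J b - J a := by
    intro a b
    have hpos : ∀ x ∈ Set.uIcc (Real.exp a) (Real.exp b), 0 < x := fun x hx =>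
      (lt_min (Real.exp_pos a) (Real.exp_pos b)).trans_le hx.1
    rw [intervalIntegral.integral_eq_sub_of_hasDerivAt (f := fun x => J (Real.log x))
      (fun x hx => hFd x (hpos x hx)) ?_]
    · simp only [Real.log_exp]
    · refine ContinuousOn.intervalIntegrable ?_
      have hc : ContinuousOn (fun x : ℝ => Complex.exp (γ * (Real.log x : ℝ))
          * W.eval ((Real.log x : ℝ) : ℂ)) (Set.uIcc (Real.exp a) (Real.exp b)) := by
        have hl : ContinuousOn Real.log (Set.uIcc (Real.exp a) (Real.exp b)) :=
          Real.continuousOn_log.mono fun x hx => (hpos x hx).ne'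
        have hk : Continuous fun u : ℝ => Complex.exp (γ * u) * W.eval (u : ℂ) := by
          have := W.continuous
          fun_prop
        exact hk.comp_continuousOn hl
      refine hc.congr fun x hx => ?_
      simp only [← hF, Real.exp_log (hpos x hx)]
  obtain ⟨h0, -⟩ | ⟨-, v₀, v₁, h₀, h₁, rfl⟩ := h
  · exact absurd rfl h0
  obtain ⟨P₀, hP₀, rfl⟩ := h₀.exists_expPolyAsymp
  obtain ⟨P₁, hP₁, rfl⟩ := h₁.exists_expPolyAsymp
  have e₁ := ((ExpPolyAsymp.eval_mul_exp (γ + 1) V).add (.const (-J 0))).congr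
      (g₂ := fun t => ∫ x in (1 : ℝ)..Real.exp t, F x) fun t => by
    rw [← Real.exp_zero, integral_F]
    simp [hJ, sub_eq_add_neg]
  have e₀ := ((ExpPolyAsymp.const (J 0)).add
      ((ExpPolyAsymp.eval_mul_exp (-(γ + 1)) (V.comp (-X))).const_mul (-1))).congr
      (g₂ := fun t => ∫ x in (Real.exp (-t))..1, F x) fun t => by
    rw [← Real.exp_zero, integral_F]
    simp [-neg_add_rev, neg_mul, hJ, sub_eq_add_neg]
  rw [hP₀.eq_at_zero e₀, hP₁.eq_at_zero e₁]
  by_cases hγ : γ + 1 = 0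
  · have hv := hV0 hγ
    rw [coeff_zero_eq_eval_zero] at hv
    simp [hγ, coeff_zero_eq_eval_zero, hv]
  · have hγ' : -(γ + 1) ≠ 0 := neg_ne_zero.2 hγ
    simp [-neg_add_rev, Pi.single_eq_of_ne (Ne.symm hγ), Pi.single_eq_of_ne (Ne.symm hγ')]

theorem integral_of_homogeneous {f : ℝ → ℝ → ℂ} {α : ℂ}
    (hhom : ∀ x y : ℝ, 0 < x → 0 < y → f x y = (x : ℂ) ^ α * f 1 (y / x)) (u a b : ℝ) :
    ∫ y in (Real.exp a)..(Real.exp b), f (Real.exp u) y =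
      Complex.exp ((α + 1) * u) * ∫ t in (Real.exp (a - u))..(Real.exp (b - u)), f 1 t := by
  have h1 : ∫ y in (Real.exp a)..(Real.exp b), f (Real.exp u) y =
      ∫ y in (Real.exp a)..(Real.exp b), Complex.exp (α * u) * f 1 (y / Real.exp u) := by
    refine intervalIntegral.integral_congr fun y hy => ?_
    have hy0 : 0 < y := (lt_min (Real.exp_pos a) (Real.exp_pos b)).trans_le hy.1
    rw [hhom _ _ (Real.exp_pos u) hy0, Complex.cpow_def_of_ne_zero
      (by exact_mod_cast (Real.exp_pos u).ne'), ← Complex.ofReal_log (Real.exp_pos u).le,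
      Real.log_exp, mul_comm (u : ℂ)]
  rw [h1, intervalIntegral.integral_const_mul,
    intervalIntegral.integral_comp_div (fun t => f 1 t) (Real.exp_pos u).ne',
    ← Real.exp_sub, ← Real.exp_sub, Complex.real_smul, add_mul, one_mul, Complex.exp_add,
    Complex.ofReal_exp, mul_assoc]

/-- The inner regularized integral of a homogeneous function is `x ^ (α + 1)` times a
polynomial in `log x`. -/
theorem exists_polynomial_log_of_hasRegInt {f : ℝ → ℝ → ℂ} {α : ℂ} {F : ℝ → ℂ}
    (hcont : ContinuousOn (f 1) (Set.Ioi 0))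
    (hhom : ∀ x y : ℝ, 0 < x → 0 < y → f x y = (x : ℂ) ^ α * f 1 (y / x))
    (hF : ∀ x : ℝ, 0 < x → HasRegInt (f x) 0 (F x)) :
    ∃ W : ℂ[X], ∀ u : ℝ, F (Real.exp u) = Complex.exp ((α + 1) * u) * W.eval (u : ℂ) := by
  obtain ⟨h0, -⟩ | ⟨-, w₀, w₁, hw₀, hw₁, -⟩ := hF 1 one_pos
  · exact absurd rfl h0
  obtain ⟨Q, hQ, -⟩ := hw₀.exists_expPolyAsymp
  obtain ⟨P, hP, -⟩ := hw₁.exists_expPolyAsymp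
  refine ⟨(P 0).comp (-X) + Q 0, fun u => ?_⟩
  have hii : ∀ a b : ℝ, IntervalIntegrable (f 1) volume (Real.exp a) (Real.exp b) := fun a b =>
    (hcont.mono fun x hx =>
      (lt_min (Real.exp_pos a) (Real.exp_pos b)).trans_le hx.1).intervalIntegrable
  set K : ℂ := ∫ t in (1 : ℝ)..Real.exp (-u), f 1 t with hK
  obtain ⟨h0, -⟩ | ⟨-, v₀, v₁, h₀, h₁, hv⟩ := hF (Real.exp u) (Real.exp_pos u)
  · exact absurd rfl h0
  obtain ⟨P₀, hP₀, hv₀⟩ := h₀.exists_expPolyAsymp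
  obtain ⟨P₁, hP₁, hv₁⟩ := h₁.exists_expPolyAsymp
  have e₁ := (((hP.comp_add_const (-u)).add (.const (-K))).const_mul
      (Complex.exp ((α + 1) * u))).congr
      (g₂ := fun t => ∫ y in (1 : ℝ)..Real.exp t, f (Real.exp u) y) fun t => by
    have h1 := integral_of_homogeneous hhom u 0 t
    have h2 := intervalIntegral.integral_interval_sub_left (hii 0 (t - u)) (hii 0 (-u))
    rw [zero_sub] at h1
    rw [Real.exp_zero] at h1 h2
    rw [h1, ← h2, hK]
    simp only [sub_eq_add_neg]
  have e₀ := (((hQ.comp_add_const u).add (.const K)).const_mul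
      (Complex.exp ((α + 1) * u))).congr
      (g₂ := fun t => ∫ y in (Real.exp (-t))..1, f (Real.exp u) y) fun t => by
    have h1 := integral_of_homogeneous hhom u (-t) 0
    have h2 := intervalIntegral.integral_add_adjacent_intervals (hii (-(t + u)) 0) (hii 0 (-u))
    rw [zero_sub] at h1
    rw [Real.exp_zero] at h1 h2
    rw [h1, hK, h2, neg_add, sub_eq_add_neg]
  rw [hv, ← hv₀, ← hv₁, hP₀.eq_at_zero e₀, hP₁.eq_at_zero e₁]
  simp [coeff_zero_eq_eval_zero, taylor_eval]
  ring

theorem regInt_regInt_eq_zero_of_homogeneous {f : ℝ → ℝ → ℂ} {α : ℂ} {F : ℝ → ℂ} {I : ℂ}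
    (hcont : ContinuousOn (f 1) (Set.Ioi 0))
    (hhom : ∀ x y : ℝ, 0 < x → 0 < y → f x y = (x : ℂ) ^ α * f 1 (y / x))
    (hF : ∀ x : ℝ, 0 < x → HasRegInt (f x) 0 (F x)) (hI : HasRegInt F 0 I) : I = 0 := by
  obtain ⟨W, hW⟩ := exists_polynomial_log_of_hasRegInt hcont hhom hF
  exact hI.eq_zero_of_cpow_mul_log (α + 1) W hW

/-- The doubly regularized iterated integral `⨍_0^∞ ⨍_0^∞ f` of a homogeneous function
vanishes, for both orders of integration. Here `F x = ⨍_0^∞ f(x,y) dy`,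
`G y = ⨍_0^∞ f(x,y) dx`, `I₁ = ⨍_0^∞ F`, `I₂ = ⨍_0^∞ G`. -/
theorem stmt_10 (f : ℝ × ℝ → ℂ) (α : ℂ)
    (hsm : ContDiffOn ℝ (⊤ : ℕ∞) f Qset) (hhom : Homog f α)
    (F G : ℝ → ℂ) (I₁ I₂ : ℂ)
    (hF : ∀ x : ℝ, 0 ≤ x → HasRegInt (fun y => f (x, y)) 0 (F x))
    (hG : ∀ y : ℝ, 0 ≤ y → HasRegInt (fun x => f (x, y)) 0 (G y))
    (hI₁ : HasRegInt F 0 I₁) (hI₂ : HasRegInt G 0 I₂) :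
    I₁ = 0 ∧ I₂ = 0 := by
  have hQ : ∀ x y : ℝ, 0 < x → 0 < y → (x, y) ∈ Qset := fun x y hx hy =>
    ⟨⟨hx.le, hy.le⟩, fun h => hx.ne' (congrArg Prod.fst h)⟩
  constructor
  · refine regInt_regInt_eq_zero_of_homogeneous (f := fun x y => f (x, y)) (α := α) ?_ ?_
      (fun x hx => hF x hx.le) hI₁
    · exact hsm.continuousOn.comp (by fun_prop) fun y hy => hQ 1 y one_pos hy
    · intro x y hx hy
      have := hhom x hx (1, y / x) (hQ _ _ one_pos (div_pos hy hx))
      simpa [mul_div_cancel₀ y hx.ne'] using this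
  · refine regInt_regInt_eq_zero_of_homogeneous (f := fun y x => f (x, y)) (α := α) ?_ ?_
      (fun y hy => hG y hy.le) hI₂
    · exact hsm.continuousOn.comp (by fun_prop) fun x hx => hQ x 1 hx one_pos
    · intro y x hy hx
      have := hhom y hy (x / y, 1) (hQ _ _ (div_pos hx hy) one_pos)
      simpa [mul_div_cancel₀ x hy.ne'] using this
end

section
/- Exchange of regularized limit and regularized integral: Let f : ℝ₊² \ {(0,0)} → ℂ be smooth and homogeneous of degree α ∈ ℂ, and a ≥ 0. Then LIM_{y→∞} ⨍_a^∞ f(x,y) dx = ⨍_a^∞ (LIM_{y→∞} f(x,y)) dx + Corr, where the correction term Corr equals ⨍_0^∞ f(x,1) dx if α = -1, and equals 0 otherwise. -/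
open MeasureTheory Filter Asymptotics

namespace HasRegLimAtTop

variable {g h : ℝ → ℂ} {c d : ℂ}

theorem congr' (hg : HasRegLimAtTop g c) (hgh : g =ᶠ[atTop] h) : HasRegLimAtTop h c := by
  obtain ⟨s, A, hs, ht⟩ := hg
  refine ⟨s, A, hs, ht.congr' ?_⟩
  filter_upwards [hgh] with x hx
  rw [hx]

theorem of_tendsto (hg : Tendsto g atTop (nhds c)) : HasRegLimAtTop g c :=
  ⟨∅, 0, by simp, by simpa using hg.sub_const c⟩

theorem add (hg : HasRegLimAtTop g c) (hh : HasRegLimAtTop h d) :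
    HasRegLimAtTop (fun x => g x + h x) (c + d) := by
  classical
  obtain ⟨s, A, hs, hA⟩ := hg
  obtain ⟨t, B, ht, hB⟩ := hh
  refine ⟨s ∪ t, fun p => (if p ∈ s then A p else 0) + (if p ∈ t then B p else 0), ?_, ?_⟩
  · intro p hp
    rcases Finset.mem_union.1 hp with hp | hp
    exacts [hs p hp, ht p hp]
  · have key : ∀ x, ∑ p ∈ s ∪ t, ((if p ∈ s then A p else 0) + (if p ∈ t then B p else 0)) *
        CTerm p x = ∑ p ∈ s, A p * CTerm p x + ∑ p ∈ t, B p * CTerm p x := by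
      intro x
      simp only [add_mul, Finset.sum_add_distrib, ite_mul, zero_mul, ← Finset.sum_filter]
      congr 2
      · ext p; simp
      · ext p; simp
    have := hA.add hB
    rw [add_zero] at this
    refine this.congr fun x => ?_
    rw [key]; ring

theorem const_mul (b : ℂ) (hg : HasRegLimAtTop g c) :
    HasRegLimAtTop (fun x => b * g x) (b * c) := by
  obtain ⟨s, A, hs, hA⟩ := hg
  refine ⟨s, fun p => b * A p, hs, ?_⟩
  have := hA.const_mul b
  rw [mul_zero] at this
  refine this.congr fun x => ?_
  simp only [mul_assoc, ← Finset.mul_sum]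
  ring

theorem sub (hg : HasRegLimAtTop g c) (hh : HasRegLimAtTop h d) :
    HasRegLimAtTop (fun x => g x - h x) (c - d) := by
  have := hg.add (hh.const_mul (-1))
  simpa [sub_eq_add_neg] using this

theorem sum {ι : Type*} (S : Finset ι) {u : ι → ℝ → ℂ} {e : ι → ℂ}
    (hu : ∀ i ∈ S, HasRegLimAtTop (u i) (e i)) :
    HasRegLimAtTop (fun x => ∑ i ∈ S, u i x) (∑ i ∈ S, e i) := by
  classical
  induction S using Finset.induction_on with
  | empty => simpa using of_tendsto (tendsto_const_nhds (x := (0 : ℂ)))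
  | insert i S hi ih =>
    simp only [Finset.sum_insert hi]
    exact (hu i (Finset.mem_insert_self _ _)).add
      (ih fun j hj => hu j (Finset.mem_insert_of_mem hj))

end HasRegLimAtTop

theorem norm_CTerm {x : ℝ} (hx : 1 < x) (p : ℂ × ℕ) :
    ‖CTerm p x‖ = x ^ p.1.re * Real.log x ^ p.2 := by
  have h0 : 0 < x := by linarith
  have hl := Real.log_pos hx
  rw [CTerm, norm_mul, Complex.norm_cpow_eq_rpow_re_of_pos h0, norm_pow, Complex.norm_real,
    Real.norm_of_nonneg hl.le]

theorem tendsto_rpow_mul_log_pow_atTop {r : ℝ} (hr : r < 0) (k : ℕ) :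
    Tendsto (fun x : ℝ => x ^ r * Real.log x ^ k) atTop (nhds 0) := by
  have h := (isLittleO_log_rpow_rpow_atTop (k : ℝ) (neg_pos.2 hr)).tendsto_div_nhds_zero
  refine h.congr' ?_
  filter_upwards [eventually_gt_atTop 1] with x hx
  rw [Real.rpow_natCast, Real.rpow_neg (by linarith), div_inv_eq_mul, mul_comm]

theorem tendsto_CTerm_of_re_neg {p : ℂ × ℕ} (hp : p.1.re < 0) :
    Tendsto (CTerm p) atTop (nhds 0) := by
  rw [tendsto_zero_iff_norm_tendsto_zero]
  refine (tendsto_rpow_mul_log_pow_atTop hp p.2).congr' ?_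
  filter_upwards [eventually_gt_atTop 1] with x hx
  rw [norm_CTerm hx]

theorem hasRegLimAtTop_CTerm (p : ℂ × ℕ) :
    HasRegLimAtTop (CTerm p) (if p = (0, 0) then 1 else 0) := by
  split_ifs with h
  · refine .of_tendsto (tendsto_const_nhds.congr fun x => ?_)
    simp [h, CTerm]
  · rcases lt_or_ge p.1.re 0 with hp | hp
    · exact .of_tendsto (tendsto_CTerm_of_re_neg hp)
    · exact ⟨{p}, 1, by simpa using ⟨hp, h⟩, by simp⟩

/-- Distinct purely oscillating powers are linearly independent modulo `o(1)`. -/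
theorem eq_zero_of_tendsto_sum_cpow {ι : Type*} (S : Finset ι) (z : ι → ℂ)
    (hre : ∀ i ∈ S, (z i).re = 0) (hinj : Set.InjOn z S) (A : ι → ℂ)
    (h : Tendsto (fun x : ℝ => ∑ i ∈ S, A i * (x : ℂ) ^ z i) atTop (nhds 0)) :
    ∀ i ∈ S, A i = 0 := by
  classical
  induction S using Finset.induction_on generalizing A with
  | empty => simp
  | insert m S hm ih =>
    have hS : ∀ i ∈ S, A i = 0 := by
      intro i hi
      have hne : z i - z m ≠ 0 := by
        intro h0
        have := hinj (Finset.mem_insert_of_mem hi) (Finset.mem_insert_self _ _) (sub_eq_zero.1 h0)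
        exact hm (this ▸ hi)
      have hre0 : (z i - z m).re = 0 := by
        simp [hre i (Finset.mem_insert_of_mem hi), hre m (Finset.mem_insert_self _ _)]
      have him : (z i - z m).im ≠ 0 := fun h0 => hne (Complex.ext hre0 h0)
      set r : ℝ := Real.exp (Real.pi / (z i - z m).im) with hr
      have hr0 : 0 < r := Real.exp_pos _
      have hrp : (r : ℂ) ^ (z i - z m) = -1 := by
        rw [Complex.cpow_def_of_ne_zero (by exact_mod_cast hr0.ne'), ← Complex.ofReal_log hr0.le,
          hr, Real.log_exp]
        have : z i - z m = ((z i - z m).im : ℂ) * Complex.I := by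
          apply Complex.ext <;> simp [hre i (Finset.mem_insert_of_mem hi),
            hre m (Finset.mem_insert_self _ _)]
        rw [← Complex.exp_pi_mul_I]
        congr 1
        conv_lhs => rw [this]
        have h' : ((z i - z m).im : ℂ) ≠ 0 := by exact_mod_cast him
        simp only [Complex.mul_I_im, Complex.ofReal_re, Complex.ofReal_div]
        field_simp
      have hsh : Tendsto (fun x : ℝ => ∑ j ∈ S, (A j * ((r : ℂ) ^ z j - (r : ℂ) ^ z m)) *
          (x : ℂ) ^ z j) atTop (nhds 0) := by
        have h1 := h.comp (tendsto_id.const_mul_atTop hr0)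
        have h2 := h1.sub (h.const_mul ((r : ℂ) ^ z m))
        rw [mul_zero, sub_zero] at h2
        refine h2.congr' ?_
        filter_upwards [eventually_gt_atTop 0] with x hx
        simp only [Function.comp, id, Complex.ofReal_mul,
          Complex.mul_cpow_ofReal_nonneg hr0.le hx.le]
        rw [Finset.mul_sum, ← Finset.sum_sub_distrib, Finset.sum_insert hm,
          show A m * ((r : ℂ) ^ z m * (x : ℂ) ^ z m) - (r : ℂ) ^ z m * (A m * (x : ℂ) ^ z m) = 0
            by ring, zero_add]
        exact Finset.sum_congr rfl fun j _ => by ring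
      have := ih (fun j hj => hre j (Finset.mem_insert_of_mem hj))
        (hinj.mono (by simp)) _ hsh i hi
      refine (mul_eq_zero.1 this).resolve_right fun h0 => ?_
      have hr0' : (r : ℂ) ≠ 0 := by exact_mod_cast hr0.ne'
      have hzm : (r : ℂ) ^ z m ≠ 0 := by simp [Complex.cpow_eq_zero_iff, hr0']
      rw [Complex.cpow_sub _ _ hr0', sub_eq_zero.1 h0, div_self hzm] at hrp
      norm_num at hrp
    intro i hi
    rcases Finset.mem_insert.1 hi with rfl | hi
    · rw [tendsto_zero_iff_norm_tendsto_zero] at h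
      have : Tendsto (fun _ : ℝ => ‖A i‖) atTop (nhds 0) := by
        refine h.congr' ?_
        filter_upwards [eventually_gt_atTop 0] with x hx
        rw [Finset.sum_insert hm, Finset.sum_eq_zero (fun j hj => by rw [hS j hj, zero_mul]),
          add_zero, norm_mul, Complex.norm_cpow_eq_rpow_re_of_pos hx,
          hre i (Finset.mem_insert_self _ _), Real.rpow_zero, mul_one]
      exact norm_eq_zero.1 (tendsto_nhds_unique tendsto_const_nhds this)
    · exact hS i hi

/-- The non-decaying terms of an asymptotic expansion are linearly independent modulo `o(1)`. -/
theorem eq_zero_of_tendsto_sum_CTerm (s : Finset (ℂ × ℕ)) (A : ℂ × ℕ → ℂ)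
    (hs : ∀ p ∈ s, 0 ≤ p.1.re)
    (h : Tendsto (fun x : ℝ => ∑ p ∈ s, A p * CTerm p x) atTop (nhds 0)) :
    ∀ p ∈ s, A p = 0 := by
  classical
  by_contra! hne
  obtain ⟨p₀, hp₀, hA₀⟩ := hne
  obtain ⟨m, hm, hmax⟩ := Finset.exists_max_image (s.filter fun p => A p ≠ 0)
    (fun p => toLex (p.1.re, p.2)) ⟨p₀, by simp [hp₀, hA₀]⟩
  obtain ⟨hms, hAm⟩ := Finset.mem_filter.1 hm
  set D : ℝ → ℂ := fun x => (x : ℂ) ^ (-(m.1.re : ℂ)) * ((Real.log x : ℂ) ^ m.2)⁻¹ with hD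
  set S := s.filter fun p => A p ≠ 0 ∧ p.1.re = m.1.re ∧ p.2 = m.2 with hS
  have hDnorm : ∀ x : ℝ, 1 < x → ‖D x‖ = x ^ (-m.1.re) * (Real.log x ^ m.2)⁻¹ := by
    intro x hx
    rw [hD]
    simp only [norm_mul, norm_inv, norm_pow, Complex.norm_real,
      Real.norm_of_nonneg (Real.log_pos hx).le]
    rw [Complex.norm_cpow_eq_rpow_re_of_pos (by linarith)]
    simp
  have hmul : Tendsto (fun x : ℝ => ∑ p ∈ s, A p * (CTerm p x * D x)) atTop (nhds 0) := by
    rw [tendsto_zero_iff_norm_tendsto_zero] at h ⊢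
    refine squeeze_zero' (Eventually.of_forall fun x => norm_nonneg _) ?_ h
    filter_upwards [eventually_ge_atTop (Real.exp 1)] with x hx
    have hx1 : 1 < x := lt_of_lt_of_le (by simp) hx
    have hl : 1 ≤ Real.log x := by rwa [Real.le_log_iff_exp_le (by linarith)]
    have : ‖D x‖ ≤ 1 := by
      rw [hDnorm x hx1]
      refine mul_le_one₀ (Real.rpow_le_one_of_one_le_of_nonpos hx1.le (by linarith [hs m hms]))
        (by positivity) (inv_le_one_of_one_le₀ (one_le_pow₀ hl))
    simp only [← mul_assoc, ← Finset.sum_mul]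
    rw [norm_mul]
    exact mul_le_of_le_one_right (norm_nonneg _) this
  have hlow : Tendsto (fun x : ℝ => ∑ p ∈ s.filter (fun p => ¬ (A p ≠ 0 ∧ p.1.re = m.1.re ∧
      p.2 = m.2)), A p * (CTerm p x * D x)) atTop (nhds 0) := by
    refine Eq.subst (motive := fun l => Tendsto _ atTop (nhds l)) Finset.sum_const_zero
      (tendsto_finsetSum _ fun p hp => ?_)
    obtain ⟨hps, hpn⟩ := Finset.mem_filter.1 hp
    by_cases hAp : A p = 0
    · simp [hAp]
    refine Eq.subst (motive := fun l => Tendsto _ atTop (nhds l)) (mul_zero (A p))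
      (Tendsto.const_mul _ ?_)
    rw [tendsto_zero_iff_norm_tendsto_zero]
    have hle := hmax p (by simp [hps, hAp])
    rw [Prod.Lex.toLex_le_toLex] at hle
    rcases hle with hlt | ⟨heq, hle⟩
    · simp only at hlt
      refine squeeze_zero' (Eventually.of_forall fun x => norm_nonneg _) ?_
        (tendsto_rpow_mul_log_pow_atTop (sub_neg.2 hlt) p.2)
      filter_upwards [eventually_ge_atTop (Real.exp 1)] with x hx
      have hx1 : 1 < x := lt_of_lt_of_le (by simp) hx
      have hl : 1 ≤ Real.log x := by rwa [Real.le_log_iff_exp_le (by linarith)]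
      rw [norm_mul, hDnorm x hx1, norm_CTerm hx1, sub_eq_add_neg, Real.rpow_add (by linarith)]
      have h1 : (Real.log x ^ m.2)⁻¹ ≤ 1 := inv_le_one_of_one_le₀ (one_le_pow₀ hl)
      have h2 : 0 ≤ x ^ p.1.re * x ^ (-m.1.re) * Real.log x ^ p.2 := by positivity
      calc _ = x ^ p.1.re * x ^ (-m.1.re) * Real.log x ^ p.2 * (Real.log x ^ m.2)⁻¹ := by ring
        _ ≤ _ := mul_le_of_le_one_right h2 h1
    · simp only at heq hle
      have hlt : p.2 < m.2 := lt_of_le_of_ne hle fun h' => hpn ⟨hAp, heq, h'⟩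
      have hlog : Tendsto (fun x : ℝ => (Real.log x)⁻¹) atTop (nhds 0) :=
        tendsto_inv_atTop_zero.comp Real.tendsto_log_atTop
      have hlog' := hlog.pow (m.2 - p.2)
      rw [zero_pow (by omega)] at hlog'
      refine hlog'.congr' ?_
      filter_upwards [eventually_gt_atTop 1] with x hx1
      have hl := Real.log_pos hx1
      have hx0 : 0 < x := by linarith
      rw [norm_mul, hDnorm x hx1, norm_CTerm hx1, heq, Real.rpow_neg hx0.le]
      have hxr := (Real.rpow_pos_of_pos hx0 m.1.re).ne'
      obtain ⟨j, hj⟩ := Nat.exists_eq_add_of_le hle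
      rw [hj, Nat.add_sub_cancel_left, pow_add, inv_pow]
      field_simp
  have hSt : Tendsto (fun x : ℝ => ∑ p ∈ S, A p * (x : ℂ) ^ (p.1 - m.1.re)) atTop (nhds 0) := by
    have := hmul.sub hlow
    rw [sub_zero] at this
    refine this.congr' ?_
    filter_upwards [eventually_gt_atTop 1] with x hx1
    rw [← Finset.sum_filter_add_sum_filter_not s (fun p => A p ≠ 0 ∧ p.1.re = m.1.re ∧ p.2 = m.2),
      add_sub_cancel_right]
    refine Finset.sum_congr rfl fun p hp => ?_
    obtain ⟨-, -, -, hp2⟩ := Finset.mem_filter.1 hp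
    have hx0 : (x : ℂ) ≠ 0 := by exact_mod_cast (by linarith : x ≠ 0)
    have hl : (Real.log x : ℂ) ≠ 0 := by exact_mod_cast (Real.log_pos hx1).ne'
    rw [CTerm, hD, hp2, sub_eq_add_neg, Complex.cpow_add _ _ hx0]
    field_simp
  refine hAm (eq_zero_of_tendsto_sum_cpow S (fun p => p.1 - m.1.re) ?_ ?_ A hSt m ?_)
  · intro p hp
    simp [(Finset.mem_filter.1 hp).2.2.1]
  · intro p hp q hq hpq
    have h1 := (Finset.mem_filter.1 hp).2.2.2
    have h2 := (Finset.mem_filter.1 hq).2.2.2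
    exact Prod.ext (sub_left_injective hpq) (h1.trans h2.symm)
  · simp [hS, hms, hAm]

/-- The constant term of an asymptotic expansion at infinity is unique. -/
theorem HasRegLimAtTop.unique {g : ℝ → ℂ} {c d : ℂ} (hc : HasRegLimAtTop g c)
    (hd : HasRegLimAtTop g d) : c = d := by
  classical
  obtain ⟨s, A, hs, hA⟩ := hc.sub hd
  have h0 : ((0, 0) : ℂ × ℕ) ∉ s := fun h => (hs _ h).2 rfl
  have key := eq_zero_of_tendsto_sum_CTerm (insert (0, 0) s)
    (fun p => if p = (0, 0) then c - d else A p) ?_ ?_ (0, 0) (Finset.mem_insert_self _ _)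
  · simpa [sub_eq_zero] using key
  · intro p hp
    rcases Finset.mem_insert.1 hp with rfl | hp
    · simp
    · exact (hs p hp).1
  · have := hA.neg
    rw [neg_zero] at this
    refine this.congr fun x => ?_
    have hsum : ∑ p ∈ s, (if p = (0, 0) then c - d else A p) * CTerm p x =
        ∑ p ∈ s, A p * CTerm p x :=
      Finset.sum_congr rfl fun p hp => by rw [if_neg (hs p hp).2]
    rw [Finset.sum_insert h0, hsum]
    simp [CTerm]

theorem CTerm_inv {x : ℝ} (hx : 0 < x) (p : ℂ × ℕ) :
    CTerm p x⁻¹ = (-1) ^ p.2 * CTerm (-p.1, p.2) x := by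
  rw [CTerm, CTerm, Complex.ofReal_inv, Complex.inv_cpow, Complex.cpow_neg, Real.log_inv,
    Complex.ofReal_neg, neg_pow]
  · ring
  · rw [Complex.arg_ofReal_of_nonneg hx.le]
    exact Real.pi_pos.ne

/-- Inversion exchanges regularized limits at zero and at infinity. -/
theorem HasRegLimAtZero.comp_inv {g : ℝ → ℂ} {c : ℂ} (hg : HasRegLimAtZero g c) :
    HasRegLimAtTop (fun x => g x⁻¹) c := by
  obtain ⟨s, A, hs, hA⟩ := hg
  have h1 : HasRegLimAtTop (fun x => g x⁻¹ - ∑ p ∈ s, A p * CTerm p x⁻¹ - c) 0 :=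
    .of_tendsto (hA.comp tendsto_inv_atTop_nhdsGT_zero)
  have h2 : HasRegLimAtTop (fun x => ∑ p ∈ s, A p * CTerm p x⁻¹) (∑ p ∈ s, 0) := by
    refine .sum s fun p hp => ?_
    have := (hasRegLimAtTop_CTerm (-p.1, p.2)).const_mul (A p * (-1) ^ p.2)
    rw [if_neg (fun h => (hs p hp).2 (by simpa [Prod.ext_iff] using h)), mul_zero] at this
    refine this.congr' ?_
    filter_upwards [eventually_gt_atTop 0] with x hx
    rw [CTerm_inv hx, mul_assoc]
  have h3 := (h1.add h2).add (.of_tendsto (tendsto_const_nhds (x := c)))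
  simp only [Finset.sum_const_zero, zero_add] at h3
  exact h3.congr' (.of_forall fun x => by ring)

theorem HasRegLimAtZero.eq_of_tendsto {g : ℝ → ℂ} {c d : ℂ} (hg : HasRegLimAtZero g c)
    (hd : Tendsto g (nhdsWithin 0 (Set.Ioi 0)) (nhds d)) : c = d :=
  hg.comp_inv.unique (.of_tendsto (hd.comp tendsto_inv_atTop_nhdsGT_zero))

theorem ContinuousOn.intervalIntegrable_of_nonneg {g : ℝ → ℂ} (hg : ContinuousOn g (Set.Ici 0))
    {a b : ℝ} (ha : 0 ≤ a) (hb : 0 ≤ b) : IntervalIntegrable g volume a b :=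
  (hg.mono fun _ hx => (le_min ha hb).trans hx.1).intervalIntegrable

theorem integral_ofReal_pow (r : ℝ) (j : ℕ) :
    ∫ x in (0 : ℝ)..r, (x : ℂ) ^ j = (r : ℂ) ^ (j + 1) / (j + 1) := by
  have : ∫ x in (0 : ℝ)..r, (x : ℂ) ^ j = ∫ x in (0 : ℝ)..r, ((x ^ j : ℝ) : ℂ) := by
    simp only [Complex.ofReal_pow]
  rw [this, intervalIntegral.integral_ofReal, integral_pow]
  simp

/-- For `g` continuous on `[0, ∞)`, the regularized integral from `a` differs from the constant
term of `∫_0^R g` by `∫_0^a g`. -/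
theorem HasRegInt.hasRegLimAtTop {g : ℝ → ℂ} (hg : ContinuousOn g (Set.Ici 0)) {a : ℝ}
    (ha : 0 ≤ a) {v : ℂ} (hv : HasRegInt g a v) :
    HasRegLimAtTop (fun R => ∫ x in (0 : ℝ)..R, g x) (v + ∫ x in (0 : ℝ)..a, g x) := by
  have base : ∀ b w, 0 ≤ b → HasRegLimAtTop (fun R => ∫ x in b..R, g x) w →
      HasRegLimAtTop (fun R => ∫ x in (0 : ℝ)..R, g x) (w + ∫ x in (0 : ℝ)..b, g x) := by
    intro b w hb hw
    refine (hw.add (.of_tendsto (tendsto_const_nhds (x := ∫ x in (0 : ℝ)..b, g x)))).congr' ?_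
    filter_upwards [eventually_ge_atTop 0] with R hR
    rw [add_comm, intervalIntegral.integral_add_adjacent_intervals
      (hg.intervalIntegrable_of_nonneg le_rfl hb) (hg.intervalIntegrable_of_nonneg hb hR)]
  rcases hv with ⟨-, hv⟩ | ⟨rfl, v₀, v₁, h₀, h₁, rfl⟩
  · exact base a v ha hv
  · have hint : IntervalIntegrable g volume 0 1 :=
      hg.intervalIntegrable_of_nonneg le_rfl zero_le_one
    have hlim : Tendsto (fun e => ∫ x in e..1, g x) (nhdsWithin 0 (Set.Ioi 0))
        (nhds (∫ x in (0 : ℝ)..1, g x)) := by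
      have hc := intervalIntegral.continuousOn_primitive_interval_left
        (f := g) (μ := volume) (a := 0) (b := 1) (by
          rw [Set.uIcc_of_le zero_le_one, integrableOn_Icc_iff_integrableOn_Ioc]
          exact (intervalIntegrable_iff_integrableOn_Ioc_of_le zero_le_one).1 hint)
      have := (hc 0 Set.left_mem_uIcc).tendsto
      rw [Set.uIcc_of_le zero_le_one] at this
      refine this.mono_left ?_
      rw [← nhdsWithin_Ioc_eq_nhdsGT (zero_lt_one' ℝ)]
      exact nhdsWithin_mono _ Set.Ioc_subset_Icc_self
    have := base 1 v₁ zero_le_one h₁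
    rw [h₀.eq_of_tendsto hlim, intervalIntegral.integral_same, add_zero, add_comm]
    exact this

theorem HasRegLimAtTop.scale {H : ℝ → ℂ} {C : ℂ} (s : Finset (ℂ × ℕ)) (A : ℂ × ℕ → ℂ)
    (hH : Tendsto (fun x => H x - ∑ p ∈ s, A p * CTerm p x - C) atTop (nhds 0))
    {y : ℝ} (hy : 0 < y) :
    HasRegLimAtTop (fun R => H (R / y))
      (C + ∑ p ∈ s, A p * if p.1 = 0 then (-Real.log y : ℂ) ^ p.2 else 0) := by
  have hdiv : Tendsto (fun R : ℝ => R / y) atTop atTop := tendsto_id.atTop_div_const hy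
  have h1 : HasRegLimAtTop (fun R => H (R / y) - ∑ p ∈ s, A p * CTerm p (R / y) - C) 0 :=
    .of_tendsto (hH.comp hdiv)
  have h2 : ∀ p : ℂ × ℕ, HasRegLimAtTop (fun R => CTerm p (R / y))
      (if p.1 = 0 then (-Real.log y : ℂ) ^ p.2 else 0) := by
    intro p
    have h3 : HasRegLimAtTop (fun R => ∑ m ∈ Finset.range (p.2 + 1),
        ((y : ℂ) ^ (-p.1) * (-Real.log y : ℂ) ^ (p.2 - m) * (p.2.choose m : ℂ)) *
          CTerm (p.1, m) R)
        (∑ m ∈ Finset.range (p.2 + 1),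
        ((y : ℂ) ^ (-p.1) * (-Real.log y : ℂ) ^ (p.2 - m) * (p.2.choose m : ℂ)) *
          (if (p.1, m) = (0, 0) then 1 else 0)) :=
      .sum _ fun m _ => (hasRegLimAtTop_CTerm _).const_mul _
    have hval : (∑ m ∈ Finset.range (p.2 + 1),
        ((y : ℂ) ^ (-p.1) * (-Real.log y : ℂ) ^ (p.2 - m) * (p.2.choose m : ℂ)) *
          (if (p.1, m) = (0, 0) then 1 else 0)) =
        if p.1 = 0 then (-Real.log y : ℂ) ^ p.2 else 0 := by
      split_ifs with hp
      · rw [Finset.sum_eq_single 0]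
        · simp [hp]
        · intro m _ hm
          simp [hm]
        · simp
      · exact Finset.sum_eq_zero fun m _ => by simp [hp]
    rw [hval] at h3
    refine h3.congr' ?_
    filter_upwards [eventually_gt_atTop 0] with R hR
    have hy0 : (y : ℂ) ≠ 0 := by exact_mod_cast hy.ne'
    rw [CTerm, Real.log_div hR.ne' hy.ne', Complex.ofReal_sub, sub_eq_add_neg, add_pow,
      div_eq_mul_inv, Complex.ofReal_mul, Complex.mul_cpow_ofReal_nonneg hR.le (inv_pos.2 hy).le,
      Complex.ofReal_inv, Complex.inv_cpow _ _ (by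
        rw [Complex.arg_ofReal_of_nonneg hy.le]; exact Real.pi_pos.ne), Complex.cpow_neg,
      Finset.mul_sum]
    refine Finset.sum_congr rfl fun m _ => ?_
    rw [CTerm]
    ring
  have h4 := (h1.add (.sum s fun p _ => (h2 p).const_mul (A p))).add
    (.of_tendsto (tendsto_const_nhds (x := C)))
  rw [zero_add, add_comm] at h4
  exact h4.congr' (.of_forall fun x => by ring)

section Homogeneous

variable {f : ℝ × ℝ → ℂ} {α : ℂ}

theorem Homog.apply_eq (hhom : Homog f α) {x y : ℝ} (hx : 0 ≤ x) (hy : 0 < y) :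
    f (x, y) = (y : ℂ) ^ α * f (x / y, 1) := by
  rw [← hhom y hy (x / y, 1) ⟨⟨div_nonneg hx hy.le, zero_le_one⟩, by simp⟩]
  simp [mul_div_cancel₀ _ hy.ne']

theorem contDiffOn_slice (hsm : ContDiffOn ℝ (⊤ : ℕ∞) f Qset) {y : ℝ} (hy : 0 < y) :
    ContDiffOn ℝ (⊤ : ℕ∞) (fun x => f (x, y)) (Set.Ici 0) :=
  hsm.comp (contDiff_id.prodMk contDiff_const).contDiffOn
    fun _ hx => ⟨⟨hx, hy.le⟩, by simp [hy.ne']⟩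

theorem Homog.integral_eq (hhom : Homog f α) {R y : ℝ} (hR : 0 ≤ R) (hy : 0 < y) :
    ∫ x in (0 : ℝ)..R, f (x, y) = (y : ℂ) ^ (α + 1) * ∫ x in (0 : ℝ)..R / y, f (x, 1) := by
  have h1 : ∫ x in (0 : ℝ)..R, f (x, y) = ∫ x in (0 : ℝ)..R, (y : ℂ) ^ α * f (x / y, 1) := by
    refine intervalIntegral.integral_congr fun x hx => ?_
    rw [Set.uIcc_of_le hR] at hx
    exact hhom.apply_eq hx.1 hy
  have hy0 : (y : ℂ) ≠ 0 := by exact_mod_cast hy.ne'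
  rw [h1, intervalIntegral.integral_const_mul,
    intervalIntegral.integral_comp_div (fun t => f (t, 1)) hy.ne', zero_div,
    Complex.cpow_add _ _ hy0, Complex.cpow_one, Complex.real_smul, mul_assoc]

/-- Expansion of a smooth homogeneous function in powers of `x / y`. -/
theorem Homog.exists_expansion (hhom : Homog f α) (hsm : ContDiffOn ℝ (⊤ : ℕ∞) f Qset) :
    ∃ (n : ℕ) (c : ℕ → ℂ) (K : ℝ), α.re < n ∧ 0 ≤ K ∧ ∀ x y : ℝ, 0 ≤ x → 0 < y → x ≤ y →
      ‖f (x, y) - ∑ j ∈ Finset.range n, c j * (x : ℂ) ^ j * (y : ℂ) ^ (α - j)‖ ≤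
        K * x ^ n * y ^ (α.re - n) := by
  obtain ⟨n, hn⟩ := exists_nat_gt α.re
  have hg : ContDiffOn ℝ (n + 1) (fun t => f (t, 1)) (Set.Icc 0 1) :=
    ((contDiffOn_slice hsm one_pos).mono Set.Icc_subset_Ici_self).of_le (by exact_mod_cast le_top)
  obtain ⟨K, hK⟩ := exists_taylor_mean_remainder_bound zero_le_one hg
  refine ⟨n + 1, fun j => ((j.factorial : ℝ)⁻¹ : ℝ) •
    iteratedDerivWithin j (fun t => f (t, 1)) (Set.Icc 0 1) 0, |K|, ?_, abs_nonneg _, ?_⟩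
  · push_cast; linarith
  intro x y hx hy hxy
  have hy0 : (y : ℂ) ≠ 0 := by exact_mod_cast hy.ne'
  have hmem : x / y ∈ Set.Icc (0 : ℝ) 1 := ⟨by positivity, (div_le_one hy).2 hxy⟩
  have hb := hK _ hmem
  rw [taylor_within_apply, sub_zero] at hb
  have heq : f (x, y) - ∑ j ∈ Finset.range (n + 1), (((j.factorial : ℝ)⁻¹ : ℝ) •
      iteratedDerivWithin j (fun t => f (t, 1)) (Set.Icc 0 1) 0) * (x : ℂ) ^ j *
        (y : ℂ) ^ (α - j) = (y : ℂ) ^ α * (f (x / y, 1) - ∑ j ∈ Finset.range (n + 1),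
          (((j.factorial : ℝ)⁻¹ * (x / y) ^ j) •
            iteratedDerivWithin j (fun t => f (t, 1)) (Set.Icc 0 1) 0)) := by
    rw [hhom.apply_eq hx hy, mul_sub, Finset.mul_sum]
    congr 1
    refine Finset.sum_congr rfl fun j _ => ?_
    rw [Complex.cpow_sub _ _ hy0, Complex.cpow_natCast, Complex.real_smul, Complex.real_smul]
    push_cast
    rw [div_pow]
    field_simp
  rw [heq, norm_mul, Complex.norm_cpow_eq_rpow_re_of_pos hy, Real.rpow_sub hy, Real.rpow_natCast]
  calc _ ≤ y ^ α.re * (|K| * (x / y) ^ (n + 1)) := by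
        gcongr
        exact hb.trans (by gcongr; exact le_abs_self K)
    _ = _ := by rw [div_pow]; ring

theorem hasRegLimAtTop_cpow (β : ℂ) :
    HasRegLimAtTop (fun y => (y : ℂ) ^ β) (if β = 0 then 1 else 0) := by
  have := hasRegLimAtTop_CTerm (β, 0)
  simpa [CTerm, Prod.ext_iff] using this.congr' (h := fun y => (y : ℂ) ^ β)
    (.of_forall fun y => by simp [CTerm])

/-- An expansion in powers `y ^ (α - j)` with decaying error term has the expected constant
term. -/
theorem hasRegLimAtTop_of_norm_sub_le {g : ℝ → ℂ} {n : ℕ} (hn : α.re < n) (b : ℕ → ℂ) (K : ℝ)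
    (hg : ∀ᶠ y in atTop, ‖g y - ∑ j ∈ Finset.range n, b j * (y : ℂ) ^ (α - j)‖ ≤
      K * y ^ (α.re - n)) :
    HasRegLimAtTop g (∑ j ∈ Finset.range n, if α = j then b j else 0) := by
  have hdec : Tendsto (fun y : ℝ => K * y ^ (α.re - n)) atTop (nhds 0) := by
    have := (tendsto_rpow_neg_atTop (y := n - α.re) (by linarith)).const_mul K
    rwa [mul_zero, neg_sub] at this
  have h1 : HasRegLimAtTop (fun y => g y - ∑ j ∈ Finset.range n, b j * (y : ℂ) ^ (α - j)) 0 :=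
    .of_tendsto (squeeze_zero_norm' hg hdec)
  have h2 := h1.add (.sum (Finset.range n) fun j _ => (hasRegLimAtTop_cpow (α - j)).const_mul (b j))
  simp only [zero_add, sub_eq_zero, mul_ite, mul_one, mul_zero] at h2
  exact h2.congr' (.of_forall fun y => by ring)

/-- The regularized integral from zero of a homogeneous function has a constant term in `y`
only in the critical degree `-1`. -/
theorem Homog.hasRegLimAtTop_integral (hhom : Homog f α) {G : ℝ → ℂ}
    (hG : ∀ y, 0 < y → HasRegLimAtTop (fun R => ∫ x in (0 : ℝ)..R, f (x, y)) (G y)) :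
    HasRegLimAtTop G (if α = -1 then G 1 else 0) := by
  obtain ⟨s, A, hs, hA⟩ := hG 1 one_pos
  have hval : ∀ y : ℝ, 0 < y → G y = (y : ℂ) ^ (α + 1) *
      (G 1 + ∑ p ∈ s, A p * if p.1 = 0 then (-Real.log y : ℂ) ^ p.2 else 0) := by
    intro y hy
    refine (hG y hy).unique (((HasRegLimAtTop.scale s A hA hy).const_mul _).congr' ?_)
    filter_upwards [eventually_ge_atTop 0] with R hR
    rw [hhom.integral_eq hR hy]
  have h1 := (hasRegLimAtTop_CTerm (α + 1, 0)).const_mul (G 1)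
  have h2 : HasRegLimAtTop (fun y => ∑ p ∈ s, (A p * if p.1 = 0 then (-1) ^ p.2 else 0) *
      CTerm (α + 1, p.2) y) (∑ p ∈ s, 0) := by
    refine .sum s fun p hp => ?_
    convert (hasRegLimAtTop_CTerm (α + 1, p.2)).const_mul _ using 1
    by_cases hp1 : p.1 = 0
    · have : p.2 ≠ 0 := fun h => (hs p hp).2 (Prod.ext hp1 h)
      simp [this]
    · simp [hp1]
  have h3 := h1.add h2
  simp only [Finset.sum_const_zero, add_zero, Prod.mk.injEq, and_true, add_eq_zero_iff_eq_neg,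
    mul_ite, mul_one, mul_zero] at h3
  refine h3.congr' ?_
  filter_upwards [eventually_gt_atTop 0] with y hy
  rw [hval y hy, mul_add, Finset.mul_sum]
  congr 1
  · simp [CTerm, mul_comm]
  · refine Finset.sum_congr rfl fun p _ => ?_
    rw [CTerm, neg_pow]
    split_ifs <;> ring

end Homogeneous

/-- Lemma `LLimitExchange`, first formula: exchange of regularized limit and regularized
integral. Here `F y = ⨍_a^∞ f(x,y) dx`, `L x = LIM_{y→∞} f(x,y)`, `I = ⨍_a^∞ L`, and the
correction term is `Corr = ⨍_0^∞ f(x,1) dx` if `α = -1`, and `Corr = 0` otherwise; the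
conclusion is `LIM_{y→∞} F y = I + Corr`. -/
theorem stmt_11 (f : ℝ × ℝ → ℂ) (α : ℂ)
    (hsm : ContDiffOn ℝ (⊤ : ℕ∞) f Qset) (hhom : Homog f α)
    (a : ℝ) (ha : 0 ≤ a)
    (F L : ℝ → ℂ) (I Corr : ℂ)
    (hF : ∀ y : ℝ, 0 < y → HasRegInt (fun x => f (x, y)) a (F y))
    (hL : ∀ x : ℝ, 0 ≤ x → HasRegLimAtTop (fun y => f (x, y)) (L x))
    (hI : HasRegInt L a I)
    (hCorr₁ : α = -1 → HasRegInt (fun x => f (x, 1)) 0 Corr)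
    (hCorr₂ : α ≠ -1 → Corr = 0) :
    HasRegLimAtTop F (I + Corr) := by
  obtain ⟨n, c, K, hn, hK, hexp⟩ := hhom.exists_expansion hsm
  have hcont : ∀ y : ℝ, 0 < y → ContinuousOn (fun x => f (x, y)) (Set.Ici 0) :=
    fun y hy => (contDiffOn_slice hsm hy).continuousOn
  set P : ℝ → ℂ := fun x => ∑ j ∈ Finset.range n, if α = j then c j * (x : ℂ) ^ j else 0 with hP
  have hLP : ∀ x, 0 ≤ x → L x = P x := by
    intro x hx
    refine (hL x hx).unique (hasRegLimAtTop_of_norm_sub_le hn _ (K * x ^ n) ?_)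
    filter_upwards [eventually_ge_atTop x, eventually_gt_atTop 0] with y hxy hy
    exact hexp x y hx hy hxy
  have hPc : Continuous P := by
    refine continuous_finsetSum _ fun j _ => ?_
    split_ifs <;> fun_prop
  have hPint : ∀ r : ℝ, ∫ x in (0 : ℝ)..r, P x = ∑ j ∈ Finset.range n,
      if α = j then c j * ((r : ℂ) ^ (j + 1) / (j + 1)) else 0 := by
    intro r
    rw [hP, intervalIntegral.integral_finsetSum]
    · refine Finset.sum_congr rfl fun j _ => ?_
      split_ifs
      · rw [intervalIntegral.integral_const_mul, integral_ofReal_pow]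
      · simp
    · intro j _
      split_ifs
      · exact (by fun_prop : Continuous fun x : ℝ => c j * (x : ℂ) ^ j).intervalIntegrable _ _
      · simp
  have hI' : I + ∫ x in (0 : ℝ)..a, P x = 0 := by
    have hLint : ∀ r : ℝ, 0 ≤ r → ∫ x in (0 : ℝ)..r, L x = ∫ x in (0 : ℝ)..r, P x := by
      intro r hr
      refine intervalIntegral.integral_congr fun x hx => hLP x ?_
      rw [Set.uIcc_of_le hr] at hx
      exact hx.1
    have h1 := hI.hasRegLimAtTop (hPc.continuousOn.congr hLP) ha
    rw [hLint a ha] at h1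
    have h2 : HasRegLimAtTop (fun R => ∑ j ∈ Finset.range n,
        (if α = j then c j / (j + 1) else 0) * (R : ℂ) ^ ((j + 1 : ℕ) : ℂ))
        (∑ j ∈ Finset.range n, 0) := by
      refine .sum _ fun j _ => ?_
      have := (hasRegLimAtTop_cpow ((j + 1 : ℕ) : ℂ)).const_mul (if α = j then c j / (j + 1) else 0)
      rwa [if_neg (Nat.cast_ne_zero.2 j.succ_ne_zero), mul_zero] at this
    rw [Finset.sum_const_zero] at h2
    refine h1.unique (h2.congr' ?_)
    filter_upwards [eventually_ge_atTop 0] with R hR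
    rw [hLint R hR, hPint]
    refine Finset.sum_congr rfl fun j _ => ?_
    rw [Complex.cpow_natCast]
    split_ifs <;> ring
  have hlow : HasRegLimAtTop (fun y => ∫ x in (0 : ℝ)..a, f (x, y)) (∫ x in (0 : ℝ)..a, P x) := by
    rw [hPint]
    refine hasRegLimAtTop_of_norm_sub_le hn (fun j => c j * ((a : ℂ) ^ (j + 1) / (j + 1)))
      (K * a ^ n * a) ?_
    filter_upwards [eventually_ge_atTop a, eventually_gt_atTop 0] with y hay hy
    have hterm : ∀ j, Continuous fun x : ℝ => c j * (x : ℂ) ^ j * (y : ℂ) ^ (α - j) :=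
      fun j => by fun_prop
    have hsum : ∑ j ∈ Finset.range n, c j * ((a : ℂ) ^ (j + 1) / (j + 1)) * (y : ℂ) ^ (α - j) =
        ∫ x in (0 : ℝ)..a, ∑ j ∈ Finset.range n, c j * (x : ℂ) ^ j * (y : ℂ) ^ (α - j) := by
      rw [intervalIntegral.integral_finsetSum fun j _ => (hterm j).intervalIntegrable _ _]
      refine Finset.sum_congr rfl fun j _ => ?_
      rw [intervalIntegral.integral_mul_const, intervalIntegral.integral_const_mul,
        integral_ofReal_pow]
    rw [hsum, ← intervalIntegral.integral_sub
      ((hcont y hy).intervalIntegrable_of_nonneg le_rfl ha)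
      ((continuous_finsetSum _ fun j _ => hterm j).intervalIntegrable _ _)]
    have hbound := intervalIntegral.norm_integral_le_of_norm_le_const (a := 0) (b := a)
      (C := K * a ^ n * y ^ (α.re - n)) (f := fun x : ℝ => f (x, y) -
        ∑ j ∈ Finset.range n, c j * (x : ℂ) ^ j * (y : ℂ) ^ (α - j)) ?_
    · rw [sub_zero, abs_of_nonneg ha] at hbound
      exact hbound.trans_eq (by ring)
    · intro x hx
      rw [Set.uIoc_of_le ha] at hx
      refine (hexp x y hx.1.le hy (hx.2.trans hay)).trans ?_
      have := hx.1.le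
      have := hx.2
      gcongr
  have hG : ∀ y, 0 < y → HasRegLimAtTop (fun R => ∫ x in (0 : ℝ)..R, f (x, y))
      (F y + ∫ x in (0 : ℝ)..a, f (x, y)) :=
    fun y hy => (hF y hy).hasRegLimAtTop (hcont y hy) ha
  have hmain := (hhom.hasRegLimAtTop_integral hG).sub hlow
  have hcorr : (if α = -1 then F 1 + ∫ x in (0 : ℝ)..a, f (x, 1) else 0) = Corr := by
    split_ifs with h
    · have := (hCorr₁ h).hasRegLimAtTop (hcont 1 one_pos) le_rfl
      rw [intervalIntegral.integral_same, add_zero] at this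
      exact (hG 1 one_pos).unique this
    · exact (hCorr₂ h).symm
  rw [hcorr, sub_eq_add_neg, ← eq_neg_of_add_eq_zero_left hI', add_comm] at hmain
  exact hmain.congr' (.of_forall fun y => by ring)
end
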